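/- Bohr's inequality for a single Blaschke factor: for all real numbers t and r with 0 ≤ t < 1 and 0 ≤ r ≤ 1/3, one has (t + (1 - 2t²) r)/(1 - t r) ≤ 1. Consequently, for every complex a with |a| < 1 and 0 ≤ r ≤ 1/3, the Taylor coefficients a_n of the Blaschke factor φ_a satisfy ∑_{n=0}^∞ |a_n| r^n ≤ 1. -/

import Mathlib

open Filter Topology in
/-- Two complex power series that converge to the same function near `0` have the same
coefficients. -/
theorem coeff_eq_of_eventually_hasSum {c d : ℕ → ℂ} {f : ℂ → ℂ}
    (hc : ∀ᶠ z in 𝓝 (0 : ℂ), HasSum (fun n => c n * z ^ n) (f z))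
    (hd : ∀ᶠ z in 𝓝 (0 : ℂ), HasSum (fun n => d n * z ^ n) (f z)) : c = d := by
  have key : ∀ e : ℕ → ℂ, (∀ᶠ z in 𝓝 (0 : ℂ), HasSum (fun n => e n * z ^ n) (f z)) →
      HasFPowerSeriesAt f (FormalMultilinearSeries.ofScalars ℂ e) 0 := by
    intro e he
    rw [hasFPowerSeriesAt_iff]
    filter_upwards [he] with z hz
    simpa [FormalMultilinearSeries.coeff_ofScalars, mul_comm] using hz
  have h := (key c hc).eq_formalMultilinearSeries (key d hd)
  funext n
  simpa [FormalMultilinearSeries.coeff_ofScalars] using congrArg (fun p => p.coeff n) h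

/-- The Taylor coefficients at `0` of the Blaschke factor `(z - a) / (1 - conj a * z)`. -/
noncomputable def blaschkeCoeff (a : ℂ) : ℕ → ℂ
  | 0 => -a
  | n + 1 => (starRingEnd ℂ) a ^ n * (1 - (‖a‖ : ℂ) ^ 2)

theorem hasSum_blaschkeCoeff {a z : ℂ} (ha : ‖a‖ < 1) (hz : ‖z‖ < 1) :
    HasSum (fun n => blaschkeCoeff a n * z ^ n) ((z - a) / (1 - (starRingEnd ℂ) a * z)) := by
  have hlt : ‖(starRingEnd ℂ) a * z‖ < 1 := by
    rw [norm_mul, RCLike.norm_conj]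
    exact mul_lt_one_of_nonneg_of_lt_one_left (norm_nonneg a) ha hz.le
  have hne : 1 - (starRingEnd ℂ) a * z ≠ 0 := by
    intro h
    rw [← sub_eq_zero.mp h, norm_one] at hlt
    exact lt_irrefl _ hlt
  have hg := (hasSum_geometric_of_norm_lt_one hlt).mul_left ((1 - (‖a‖ : ℂ) ^ 2) * z)
  have htail : HasSum (fun n => blaschkeCoeff a (n + 1) * z ^ (n + 1))
      ((1 - (‖a‖ : ℂ) ^ 2) * z * (1 - (starRingEnd ℂ) a * z)⁻¹) := by
    have hterm : ∀ n, blaschkeCoeff a (n + 1) * z ^ (n + 1) =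
        (1 - (‖a‖ : ℂ) ^ 2) * z * ((starRingEnd ℂ) a * z) ^ n := by
      intro n
      simp only [blaschkeCoeff]
      ring
    simpa only [hterm] using hg
  convert htail.zero_add (f := fun n => blaschkeCoeff a n * z ^ n) using 1
  simp only [blaschkeCoeff, ← Complex.mul_conj']
  rw [div_eq_iff hne, add_mul, mul_assoc _ _⁻¹, inv_mul_cancel₀ hne]
  ring

theorem hasSum_norm_blaschkeCoeff {a : ℂ} {r : ℝ} (ha : ‖a‖ < 1) (hr : 0 ≤ r)
    (har : ‖a‖ * r < 1) : HasSum (fun n => ‖blaschkeCoeff a n‖ * r ^ n)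
      ((‖a‖ + (1 - 2 * ‖a‖ ^ 2) * r) / (1 - ‖a‖ * r)) := by
  have hg := (hasSum_geometric_of_lt_one (mul_nonneg (norm_nonneg a) hr) har).mul_left
    ((1 - ‖a‖ ^ 2) * r)
  have hnorm : ‖(1 - (‖a‖ : ℂ) ^ 2)‖ = 1 - ‖a‖ ^ 2 := by
    have h : 0 ≤ 1 - ‖a‖ ^ 2 := by nlinarith [norm_nonneg a]
    exact_mod_cast Complex.norm_of_nonneg h
  have htail : HasSum (fun n => ‖blaschkeCoeff a (n + 1)‖ * r ^ (n + 1))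
      ((1 - ‖a‖ ^ 2) * r * (1 - ‖a‖ * r)⁻¹) := by
    have hterm : ∀ n, ‖blaschkeCoeff a (n + 1)‖ * r ^ (n + 1) =
        (1 - ‖a‖ ^ 2) * r * (‖a‖ * r) ^ n := by
      intro n
      simp only [blaschkeCoeff, norm_mul, norm_pow, RCLike.norm_conj, hnorm]
      ring
    simpa only [hterm] using hg
  have hne : 1 - ‖a‖ * r ≠ 0 := by linarith
  convert htail.zero_add (f := fun n => ‖blaschkeCoeff a n‖ * r ^ n) using 1
  simp only [blaschkeCoeff, norm_neg]
  field_simp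
  ring

theorem bohr_majorant_le_one {t r : ℝ} (ht : 0 ≤ t) (ht1 : t < 1) (hr3 : r ≤ 1 / 3) :
    (t + (1 - 2 * t ^ 2) * r) / (1 - t * r) ≤ 1 := by
  have hpos : 0 < 1 - t * r := by nlinarith
  rw [div_le_one hpos]
  have hfac : 0 ≤ 1 - r * (1 + 2 * t) := by nlinarith
  linarith [mul_nonneg (sub_nonneg.mpr ht1.le) hfac]

/-- **Bohr's inequality for a single Blaschke factor.** For all `0 ≤ t < 1` and
`0 ≤ r ≤ 1/3`, `(t + (1 - 2t²) r)/(1 - t r) ≤ 1`; consequently, for every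
complex `a` with `|a| < 1` and `0 ≤ r ≤ 1/3`, the Taylor coefficients `(cₙ)` of
the Blaschke factor `φ_a` satisfy `∑ |cₙ| rⁿ ≤ 1`. -/
theorem bohr_single_blaschke :
    (∀ t r : ℝ, 0 ≤ t → t < 1 → 0 ≤ r → r ≤ 1 / 3 →
      (t + (1 - 2 * t ^ 2) * r) / (1 - t * r) ≤ 1) ∧
    (∀ (a : ℂ), ‖a‖ < 1 → ∀ r : ℝ, 0 ≤ r → r ≤ 1 / 3 → ∀ c : ℕ → ℂ,
      (∀ z ∈ Metric.ball (0 : ℂ) 1,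
        HasSum (fun n : ℕ => c n * z ^ n) ((z - a) / (1 - (starRingEnd ℂ) a * z))) →
      ∑' n : ℕ, ‖c n‖ * r ^ n ≤ 1) := by
  refine ⟨fun t r ht ht1 _ hr3 => bohr_majorant_le_one ht ht1 hr3, ?_⟩
  intro a ha r hr hr3 c hc
  have hball := Metric.ball_mem_nhds (0 : ℂ) one_pos
  have hcoeff : c = blaschkeCoeff a := by
    refine coeff_eq_of_eventually_hasSum (Filter.eventually_of_mem hball hc)
      (Filter.eventually_of_mem hball fun z hz => ?_)
    exact hasSum_blaschkeCoeff ha (mem_ball_zero_iff.mp hz)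
  have har : ‖a‖ * r < 1 := by nlinarith [norm_nonneg a]
  rw [hcoeff, (hasSum_norm_blaschkeCoeff ha hr har).tsum_eq]
  exact bohr_majorant_le_one (norm_nonneg a) ha hr3
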